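/- arXiv:2209.12156 — 2 statements merged into one kernel-verified Lean document; each statement's English description precedes it below -/
import Mathlib

section
/- (Theorem 1, CGMT state equations imply AMP state equations for M-estimation) Let ρ : ℝ → ℝ be convex and twice continuously differentiable, let κ > 0, τ > 0, α > 0, μ > 0, let W be a real random variable and Z an independent standard Gaussian, set b := α/μ, and assume E|∂²M_ρ/∂x²(W+τZ;b)| < ∞ and E|Z·∂M_ρ/∂x(W+τZ;b)| < ∞. If (τ, α, μ) satisfies the CGMT state equations: (i) α/2 − τ√κ − (α/μ²)·E[∂M_ρ/∂t(W+τZ; b)] = 0, (ii) −μ√κ + E[Z·∂M_ρ/∂x(W+τZ; b)] = 0, (iii) μ/2 + (1/μ)·E[∂M_ρ/∂t(W+τZ; b)] = 0, then E[(∂M_ρ/∂x(W+τZ; b))²] = τ²κ/b² and E[∂²M_ρ/∂x²(W+τZ; b)] = κ/b; i.e., (τ, b) satisfies the AMP state equations τ² = (b²/κ)·E[(∂M_ρ/∂x(W+τZ;b))²] and κ = b·E[∂²M_ρ/∂x²(W+τZ;b)]. -/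
open MeasureTheory ProbabilityTheory

lemma hasDerivAt_gaussianPDFReal_std (x : ℝ) :
    HasDerivAt (gaussianPDFReal 0 1) (-x * gaussianPDFReal 0 1 x) x := by
  have hpdf : gaussianPDFReal 0 1 =
      fun y => (Real.sqrt (2 * Real.pi))⁻¹ * Real.exp (-(y ^ 2 / 2)) := by
    ext y
    simp [gaussianPDFReal, neg_div]
  have h : HasDerivAt (fun y : ℝ => -(y ^ 2 / 2)) (-x) x := by
    exact ((hasDerivAt_pow 2 x).div_const 2).fun_neg.congr_deriv (by norm_num)
  rw [hpdf]
  exact (h.exp.const_mul (Real.sqrt (2 * Real.pi))⁻¹).congr_deriv (by ring)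

lemma integrable_gaussianReal_iff_mul {f : ℝ → ℝ} :
    Integrable f (gaussianReal 0 1) ↔ Integrable (fun x => gaussianPDFReal 0 1 x * f x) := by
  rw [gaussianReal_of_var_ne_zero 0 one_ne_zero, integrable_withDensity_iff_integrable_smul'
    (measurable_gaussianPDF 0 1) (by simp [gaussianPDF])]
  simp only [toReal_gaussianPDF, smul_eq_mul]

lemma measurable_of_hasDerivAt {h h' : ℝ → ℝ} (hd : ∀ x, HasDerivAt h (h' x) x) :
    Measurable h' := by
  rw [show h' = deriv h from funext fun x => (hd x).deriv.symm]
  exact measurable_deriv h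

/-- **Stein's lemma** for functions with bounded derivative. -/
theorem integral_id_mul_gaussianReal_eq_integral_deriv {h h' : ℝ → ℝ} {C : ℝ}
    (hd : ∀ x, HasDerivAt h (h' x) x) (hC : ∀ x, |h' x| ≤ C) :
    ∫ z, z * h z ∂(gaussianReal 0 1) = ∫ z, h' z ∂(gaussianReal 0 1) := by
  have hcont : Continuous h := continuous_iff_continuousAt.2 fun x => (hd x).continuousAt
  have hbound (x : ℝ) : |h x| ≤ |h 0| + C * |x| := by
    have := convex_univ.norm_image_sub_le_of_norm_hasDerivWithin_le
      (fun y _ => (hd y).hasDerivWithinAt) (fun y _ => hC y) (Set.mem_univ 0) (Set.mem_univ x)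
    simp only [Real.norm_eq_abs, sub_zero] at this
    linarith [abs_sub_abs_le_abs_sub (h x) (h 0)]
  have hid : MemLp (fun x : ℝ => x) 2 (gaussianReal 0 1) := memLp_id_gaussianReal' 2 (by simp)
  have hh2 : MemLp h 2 (gaussianReal 0 1) := by
    have hdom : MemLp (fun x : ℝ => |h 0| + C * |x|) 2 (gaussianReal 0 1) := by
      have habs : MemLp (fun x : ℝ => C * |x|) 2 (gaussianReal 0 1) := hid.norm.const_mul C
      exact (memLp_const |h 0|).add habs
    exact hdom.mono' hcont.aestronglyMeasurable (.of_forall hbound)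
  have hzh : Integrable (fun x => x * h x) (gaussianReal 0 1) := hid.integrable_mul hh2
  have hh : Integrable h (gaussianReal 0 1) := hh2.integrable (by norm_num)
  have hh' : Integrable h' (gaussianReal 0 1) :=
    (integrable_const C).mono' (measurable_of_hasDerivAt hd).aestronglyMeasurable (.of_forall hC)
  rw [integrable_gaussianReal_iff_mul] at hzh hh hh'
  have key := integral_mul_deriv_eq_deriv_mul_of_integrable (u := h) (u' := h')
    (v := gaussianPDFReal 0 1) (fun x _ => hd x) (fun x _ => hasDerivAt_gaussianPDFReal_std x)
    (hzh.neg.congr (.of_forall fun x => by simp only [Pi.neg_apply, Pi.mul_apply]; ring))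
    (hh'.congr (.of_forall fun x => mul_comm _ _))
    (hh.congr (.of_forall fun x => mul_comm _ _))
  rw [integral_gaussianReal_eq_integral_smul one_ne_zero,
    integral_gaussianReal_eq_integral_smul one_ne_zero]
  simp only [smul_eq_mul]
  calc ∫ x, gaussianPDFReal 0 1 x * (x * h x)
      = -∫ x, h x * (-x * gaussianPDFReal 0 1 x) := by
        rw [← integral_neg]
        exact integral_congr_ae (.of_forall fun x => by ring)
    _ = ∫ x, gaussianPDFReal 0 1 x * h' x := by
        rw [key, neg_neg]
        exact integral_congr_ae (.of_forall fun x => mul_comm _ _)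

/-- Stein's lemma after adding an independent random variable of arbitrary law. -/
theorem integral_gaussian_mul_comp_add_eq {Ω : Type*} [MeasurableSpace Ω] {P : Measure Ω}
    [IsProbabilityMeasure P] {W Z : Ω → ℝ} (hW : Measurable W) (hZ : Measurable Z)
    (hZlaw : Measure.map Z P = gaussianReal 0 1) (hindep : IndepFun W Z P)
    {g g' : ℝ → ℝ} {C : ℝ} (hd : ∀ x, HasDerivAt g (g' x) x) (hC : ∀ x, |g' x| ≤ C) (τ : ℝ)
    (hint : Integrable (fun ω => Z ω * g (W ω + τ * Z ω)) P) :
    ∫ ω, Z ω * g (W ω + τ * Z ω) ∂P = τ * ∫ ω, g' (W ω + τ * Z ω) ∂P := by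
  have hg : Measurable g :=
    (continuous_iff_continuousAt.2 fun x => (hd x).continuousAt).measurable
  have hg' : Measurable g' := measurable_of_hasDerivAt hd
  have hmap := hindep.map_prod_eq_prod_map_map hW.aemeasurable hZ.aemeasurable
  rw [hZlaw] at hmap
  have hWZ : AEMeasurable (fun ω => (W ω, Z ω)) P := (hW.prodMk hZ).aemeasurable
  have : IsProbabilityMeasure (P.map W) := Measure.isProbabilityMeasure_map hW.aemeasurable
  have hF : Measurable fun p : ℝ × ℝ => p.2 * g (p.1 + τ * p.2) := by fun_prop
  have hF' : Measurable fun p : ℝ × ℝ => τ * g' (p.1 + τ * p.2) := by fun_prop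
  have hF'C (x : ℝ) : |τ * g' x| ≤ |τ| * C := by
    rw [abs_mul]
    exact mul_le_mul_of_nonneg_left (hC x) (abs_nonneg τ)
  have hFint := (integrable_map_measure hF.aestronglyMeasurable hWZ).2 hint
  rw [hmap] at hFint
  have hF'int : Integrable (fun p : ℝ × ℝ => τ * g' (p.1 + τ * p.2))
      ((P.map W).prod (gaussianReal 0 1)) :=
    (integrable_const (|τ| * C)).mono' hF'.aestronglyMeasurable (.of_forall fun p => hF'C _)
  rw [← integral_const_mul]
  calc ∫ ω, Z ω * g (W ω + τ * Z ω) ∂P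
      = ∫ p : ℝ × ℝ, p.2 * g (p.1 + τ * p.2) ∂((P.map W).prod (gaussianReal 0 1)) := by
        rw [← hmap, integral_map hWZ hF.aestronglyMeasurable]
    _ = ∫ p : ℝ × ℝ, τ * g' (p.1 + τ * p.2) ∂((P.map W).prod (gaussianReal 0 1)) := by
        rw [integral_prod _ hFint, integral_prod _ hF'int]
        refine integral_congr_ae (.of_forall fun w => ?_)
        refine integral_id_mul_gaussianReal_eq_integral_deriv (h := fun z => g (w + τ * z))
          (h' := fun z => τ * g' (w + τ * z)) (fun z => ?_) (fun z => hF'C _)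
        have hlin : HasDerivAt (fun z : ℝ => w + τ * z) τ z := by
          simpa using ((hasDerivAt_id z).const_mul τ).const_add w
        simpa only [Function.comp_def, mul_comm τ] using (hd (w + τ * z)).comp z hlin
    _ = ∫ ω, τ * g' (W ω + τ * Z ω) ∂P := by
        rw [← hmap, integral_map hWZ hF'.aestronglyMeasurable]

section Prox

variable {ρ ρ' ρ'' : ℝ → ℝ} {b : ℝ} {prox : ℝ → ℝ}

lemma monotone_of_convexOn_hasDerivAt (hconv : ConvexOn ℝ Set.univ ρ)
    (hd1 : ∀ y, HasDerivAt ρ (ρ' y) y) : Monotone ρ' := by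
  rw [show ρ' = deriv ρ from funext fun x => (hd1 x).deriv.symm]
  exact monotoneOn_univ.1 (hconv.monotoneOn_deriv fun x _ => (hd1 x).differentiableAt)

/-- First-order optimality condition for the proximal operator. -/
lemma prox_add_mul_deriv_eq (hb : 0 < b) (hd1 : ∀ y, HasDerivAt ρ (ρ' y) y)
    (hprox : ∀ x v : ℝ,
      ρ (prox x) + (x - prox x) ^ 2 / (2 * b) ≤ ρ v + (x - v) ^ 2 / (2 * b)) (x : ℝ) :
    prox x + b * ρ' (prox x) = x := by
  have hmin : IsLocalMin (fun v => ρ v + (x - v) ^ 2 / (2 * b)) (prox x) :=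
    .of_forall (hprox x)
  have h0 := hmin.hasDerivAt_eq_zero ((hd1 (prox x)).add
    ((((hasDerivAt_id (prox x)).const_sub x).pow 2).div_const (2 * b)))
  simp only [id] at h0
  field_simp at h0
  norm_num at h0
  linarith

/-- The proximal operator of a convex `C²` function has derivative `1 / (1 + b ρ'')`. -/
lemma hasDerivAt_prox (hb : 0 < b) (hmono : Monotone ρ')
    (hd2 : ∀ y, HasDerivAt ρ' (ρ'' y) y)
    (hfoc : ∀ x, prox x + b * ρ' (prox x) = x) (x : ℝ) :
    HasDerivAt prox (1 + b * ρ'' (prox x))⁻¹ x := by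
  have hnn : 0 ≤ ρ'' (prox x) := (hd2 (prox x)).deriv ▸ hmono.deriv_nonneg
  have hle (x y : ℝ) (hxy : prox x ≤ prox y) : prox y - prox x ≤ y - x := by
    have := mul_le_mul_of_nonneg_left (hmono hxy) hb.le
    linarith [hfoc x, hfoc y]
  have hlip : LipschitzWith 1 prox := LipschitzWith.of_dist_le_mul fun x y => by
    rw [NNReal.coe_one, one_mul, Real.dist_eq, Real.dist_eq]
    rcases le_total (prox x) (prox y) with h | h
    · rw [abs_of_nonpos (by linarith), abs_of_nonpos (by linarith [hle _ _ h])]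
      linarith [hle _ _ h]
    · rw [abs_of_nonneg (by linarith), abs_of_nonneg (by linarith [hle _ _ h])]
      exact hle _ _ h
  exact HasDerivAt.of_local_left_inverse hlip.continuous.continuousAt
    ((hasDerivAt_id _).add ((hd2 _).const_mul b)) (by positivity) (.of_forall hfoc)

end Prox

/-- Theorem 1, CGMT state equations imply AMP state equations for
M-estimation: For convex twice continuously differentiable `ρ`, `κ, τ, α, μ > 0`, `W` a real
random variable, `Z` an independent standard Gaussian and `b := α/μ`, if `(τ, α, μ)` satisfies
the three CGMT state equations then `(τ, b)` satisfies the AMP state equations.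
Here `prox x` is the minimizer of `v ↦ ρ v + (x - v)^2/(2b)`, and the formulas
`∂M/∂x(x;b) = ρ'(prox x)`, `∂M/∂t(x;b) = -(1/2)(ρ'(prox x))²`,
`∂²M/∂x²(x;b) = ρ''(prox x)/(1 + bρ''(prox x))` are substituted in. -/
theorem stmt13 {Ω : Type*} [MeasureSpace Ω] [IsProbabilityMeasure (ℙ : Measure Ω)]
    (ρ ρ' ρ'' : ℝ → ℝ) (hconv : ConvexOn ℝ Set.univ ρ)
    (hd1 : ∀ y : ℝ, HasDerivAt ρ (ρ' y) y) (hd2 : ∀ y : ℝ, HasDerivAt ρ' (ρ'' y) y)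
    (hcont : Continuous ρ'')
    (κ τ α μ b : ℝ) (hκ : 0 < κ) (hτ : 0 < τ) (hα : 0 < α) (hμ : 0 < μ) (hb : b = α / μ)
    (W Z : Ω → ℝ) (hW : Measurable W) (hZ : Measurable Z)
    (hZlaw : Measure.map Z ℙ = gaussianReal 0 1) (hindep : IndepFun W Z ℙ)
    (prox : ℝ → ℝ)
    (hprox : ∀ x v : ℝ,
      ρ (prox x) + (x - prox x) ^ 2 / (2 * b) ≤ ρ v + (x - v) ^ 2 / (2 * b))
    -- E|∂²M/∂x²(W + τZ; b)| < ∞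
    (hint1 : Integrable
      (fun ω => ρ'' (prox (W ω + τ * Z ω)) / (1 + b * ρ'' (prox (W ω + τ * Z ω)))) ℙ)
    -- E|Z ∂M/∂x(W + τZ; b)| < ∞
    (hint2 : Integrable (fun ω => Z ω * ρ' (prox (W ω + τ * Z ω))) ℙ)
    -- CGMT state equation (i)
    (hcgmt1 : α / 2 - τ * Real.sqrt κ
        - (α / μ ^ 2) * ∫ ω, -(1 / 2) * (ρ' (prox (W ω + τ * Z ω))) ^ 2 ∂ℙ = 0)
    -- CGMT state equation (ii)
    (hcgmt2 : -μ * Real.sqrt κ + (∫ ω, Z ω * ρ' (prox (W ω + τ * Z ω)) ∂ℙ) = 0)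
    -- CGMT state equation (iii)
    (hcgmt3 : μ / 2 + (1 / μ) * ∫ ω, -(1 / 2) * (ρ' (prox (W ω + τ * Z ω))) ^ 2 ∂ℙ = 0) :
    -- AMP state equations
    (∫ ω, (ρ' (prox (W ω + τ * Z ω))) ^ 2 ∂ℙ) = τ ^ 2 * κ / b ^ 2 ∧
    (∫ ω, ρ'' (prox (W ω + τ * Z ω)) / (1 + b * ρ'' (prox (W ω + τ * Z ω))) ∂ℙ) = κ / b := by
  have hbpos : 0 < b := hb ▸ div_pos hα hμ
  have hmono : Monotone ρ' := monotone_of_convexOn_hasDerivAt hconv hd1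
  have hnn (y : ℝ) : 0 ≤ ρ'' y := (hd2 y).deriv ▸ hmono.deriv_nonneg
  have hfoc := prox_add_mul_deriv_eq hbpos hd1 hprox
  have hg (x : ℝ) : HasDerivAt (fun x => ρ' (prox x))
      (ρ'' (prox x) / (1 + b * ρ'' (prox x))) x :=
    (hd2 (prox x)).comp x (hasDerivAt_prox hbpos hmono hd2 hfoc x)
  have hbound (x : ℝ) : |ρ'' (prox x) / (1 + b * ρ'' (prox x))| ≤ 1 / b := by
    have h := hnn (prox x)
    rw [abs_of_nonneg (by positivity), div_le_div_iff₀ (by positivity) hbpos]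
    linarith
  have hstein := integral_gaussian_mul_comp_add_eq hW hZ hZlaw hindep hg hbound τ hint2
  rw [hstein] at hcgmt2
  rw [integral_const_mul] at hcgmt1 hcgmt3
  set G := ∫ ω, (ρ' (prox (W ω + τ * Z ω))) ^ 2 ∂ℙ
  set D := ∫ ω, ρ'' (prox (W ω + τ * Z ω)) / (1 + b * ρ'' (prox (W ω + τ * Z ω))) ∂ℙ
  have hG : G = μ ^ 2 := by
    field_simp at hcgmt3
    linarith
  have hατ : α = τ * Real.sqrt κ := by
    rw [hG] at hcgmt1
    field_simp at hcgmt1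
    linarith
  have hsq : Real.sqrt κ ^ 2 = κ := Real.sq_sqrt hκ.le
  have hD : τ * D = μ * Real.sqrt κ := by linarith
  constructor
  · rw [hG, hb, ← hsq, ← mul_pow, ← hατ]
    field_simp
  · rw [hb, div_div_eq_mul_div, eq_div_iff hα.ne']
    calc D * α = τ * D * Real.sqrt κ := by rw [hατ]; ring
      _ = Real.sqrt κ ^ 2 * μ := by rw [hD]; ring
      _ = κ * μ := by rw [hsq]
end

section
/- (Theorem 3, second identity) Let ρ(t) = log(1+exp(t)) and l(t) := ρ(−t) = log(1+exp(−t)). Let κ > 0, α > 0, σ > 0, r > 0, λ > 0. Let Z be standard Gaussian and V an independent random variable with density p_V(v) = (1/√(2π))·e^{−v²/2}·(2/(1+e^{−rv})), and let Z', V' be i.i.d. standard Gaussians. Then 1 − λ·E[ l''(Prox_l(√κ·α·Z + r·σ·V; λ)) / (1 + λ·l''(Prox_l(√κ·α·Z + r·σ·V; λ))) ] = E[ 2ρ'(r·V') / (1 + λ·ρ''(Prox_ρ(−√κ·α·Z' − r·σ·V'; λ))) ]. -/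
open MeasureTheory ProbabilityTheory

/-- The logistic loss `ρ(t) = log(1 + eᵗ)`. -/
noncomputable def logisticRho (t : ℝ) : ℝ := Real.log (1 + Real.exp t)

/-- Its derivative, the sigmoid `ρ'(t) = 1/(1 + e^{-t})`. -/
noncomputable def logisticRho' (t : ℝ) : ℝ := 1 / (1 + Real.exp (-t))

/-- Its second derivative `ρ''(t) = ρ'(t)(1 - ρ'(t))`. -/
noncomputable def logisticRho'' (t : ℝ) : ℝ := logisticRho' t * (1 - logisticRho' t)

/-- The flipped loss `l(t) = ρ(-t) = log(1 + e^{-t})`. -/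
noncomputable def logisticL (t : ℝ) : ℝ := Real.log (1 + Real.exp (-t))

/-- Its second derivative `l''(t) = ρ''(-t)`. -/
noncomputable def logisticL'' (t : ℝ) : ℝ := logisticRho'' (-t)

/-- Two minimizers of the proximal objective of the logistic loss coincide. -/
theorem logisticRho_prox_unique {lam x p q : ℝ} (hlam : 0 < lam)
    (hp : ∀ v, logisticRho p + (x - p) ^ 2 / (2 * lam) ≤ logisticRho v + (x - v) ^ 2 / (2 * lam))
    (hq : ∀ v, logisticRho q + (x - q) ^ 2 / (2 * lam) ≤ logisticRho v + (x - v) ^ 2 / (2 * lam)) :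
    p = q := by
  have hderiv (t : ℝ) : HasDerivAt (fun v => logisticRho v + (x - v) ^ 2 / (2 * lam))
      (Real.exp t / (1 + Real.exp t) + (t - x) / lam) t := by
    have h₁ : HasDerivAt logisticRho (Real.exp t / (1 + Real.exp t)) t :=
      ((Real.hasDerivAt_exp t).const_add 1).log (by positivity)
    have h₂ := (((hasDerivAt_id t).const_sub x).pow 2).div_const (2 * lam)
    refine (h₁.add h₂).congr_deriv ?_
    simp only [id]
    field_simp
    ring
  have hstat (t : ℝ) (ht : ∀ v, logisticRho t + (x - t) ^ 2 / (2 * lam)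
      ≤ logisticRho v + (x - v) ^ 2 / (2 * lam)) :
      Real.exp t / (1 + Real.exp t) + (t - x) / lam = 0 :=
    IsLocalMin.hasDerivAt_eq_zero (Filter.Eventually.of_forall ht) (hderiv t)
  have hmono : StrictMono fun t : ℝ => Real.exp t / (1 + Real.exp t) + (t - x) / lam := by
    intro a b hab
    have h₁ : Real.exp a / (1 + Real.exp a) ≤ Real.exp b / (1 + Real.exp b) := by
      rw [div_le_div_iff₀ (by positivity) (by positivity)]
      nlinarith [Real.exp_le_exp.2 hab.le]
    have h₂ : (a - x) / lam < (b - x) / lam := by gcongr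
    exact add_lt_add_of_le_of_lt h₁ h₂
  exact hmono.injective ((hstat p hp).trans (hstat q hq).symm)

/-- A proximal operator of any function is monotone. -/
theorem monotone_of_prox {f p : ℝ → ℝ} {lam : ℝ} (hlam : 0 < lam)
    (hp : ∀ x v, f (p x) + (x - p x) ^ 2 / (2 * lam) ≤ f v + (x - v) ^ 2 / (2 * lam)) :
    Monotone p := by
  intro x y hxy
  rcases hxy.eq_or_lt with rfl | hlt
  · exact le_rfl
  have hsum : ((x - p x) ^ 2 + (y - p y) ^ 2) / (2 * lam)
      ≤ ((x - p y) ^ 2 + (y - p x) ^ 2) / (2 * lam) := by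
    rw [add_div, add_div]
    linarith [hp x (p y), hp y (p x)]
  rw [div_le_div_iff_of_pos_right (by positivity)] at hsum
  by_contra! h
  nlinarith [mul_pos (sub_pos.2 hlt) (sub_pos.2 h)]

theorem logisticRho'_nonneg (t : ℝ) : 0 ≤ logisticRho' t := by
  unfold logisticRho'
  positivity

theorem logisticRho''_nonneg (t : ℝ) : 0 ≤ logisticRho'' t := by
  refine mul_nonneg (logisticRho'_nonneg t) (sub_nonneg.2 ?_)
  rw [logisticRho', div_le_one (by positivity)]
  linarith [Real.exp_pos (-t)]

theorem measurable_logisticRho' : Measurable logisticRho' := by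
  unfold logisticRho'
  fun_prop

theorem measurable_logisticRho'' : Measurable logisticRho'' :=
  measurable_logisticRho'.mul (measurable_const.sub measurable_logisticRho')

/-- The sigmoid-tilted Gaussian law has density `2ρ'(rv)` with respect to the standard Gaussian. -/
theorem gaussianReal_withDensity_logisticRho' (r : ℝ) :
    volume.withDensity (fun v => ENNReal.ofReal ((1 / Real.sqrt (2 * Real.pi))
        * Real.exp (-v ^ 2 / 2) * (2 / (1 + Real.exp (-(r * v))))))
      = (gaussianReal 0 1).withDensity (fun v => ENNReal.ofReal (2 * logisticRho' (r * v))) := by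
  have hmeas : Measurable fun v => ENNReal.ofReal (2 * logisticRho' (r * v)) :=
    ((measurable_logisticRho'.comp (measurable_const_mul r)).const_mul 2).ennreal_ofReal
  rw [gaussianReal_of_var_ne_zero 0 one_ne_zero,
    ← withDensity_mul _ (measurable_gaussianPDF 0 1) hmeas]
  congr 1
  funext v
  rw [Pi.mul_apply, gaussianPDF, ← ENNReal.ofReal_mul (gaussianPDFReal_nonneg _ _ _)]
  simp only [gaussianPDFReal, logisticRho', NNReal.coe_one, mul_one, sub_zero, div_eq_mul_inv,
    one_mul]


/-- Theorem 3, second identity: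
`1 - λ E[l''(Prox_l(√κ α Z + r σ V; λ)) / (1 + λ l''(Prox_l(√κ α Z + r σ V; λ)))]
  = E[2ρ'(rV') / (1 + λ ρ''(Prox_ρ(-√κ α Z' - r σ V'; λ)))]`,
where `Z` is standard Gaussian, `V` is independent with density
`(1/√(2π)) e^{-v²/2} · 2ρ'(rv)`, and `Z', V'` are i.i.d. standard Gaussians.
`proxl x` (resp. `proxρ x`) is the minimizer of `v ↦ l(v) + (x-v)²/(2λ)`
(resp. `v ↦ ρ(v) + (x-v)²/(2λ)`). -/
theorem stmt19 {Ω : Type*} [MeasureSpace Ω] [IsProbabilityMeasure (ℙ : Measure Ω)]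
    (κ α σ r lam : ℝ) (hκ : 0 < κ) (hα : 0 < α) (hσ : 0 < σ) (hr : 0 < r) (hlam : 0 < lam)
    (Z V Z' V' : Ω → ℝ)
    (hZ : Measurable Z) (hV : Measurable V) (hZ' : Measurable Z') (hV' : Measurable V')
    (hZlaw : Measure.map Z ℙ = gaussianReal 0 1)
    (hVlaw : Measure.map V ℙ = volume.withDensity (fun v =>
      ENNReal.ofReal ((1 / Real.sqrt (2 * Real.pi)) * Real.exp (-v ^ 2 / 2)
        * (2 / (1 + Real.exp (-(r * v)))))))
    (hindepZV : IndepFun Z V ℙ)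
    (hZ'law : Measure.map Z' ℙ = gaussianReal 0 1)
    (hV'law : Measure.map V' ℙ = gaussianReal 0 1)
    (hindepZ'V' : IndepFun Z' V' ℙ)
    (proxl proxρ : ℝ → ℝ)
    (hproxl : ∀ x v : ℝ,
      logisticL (proxl x) + (x - proxl x) ^ 2 / (2 * lam)
        ≤ logisticL v + (x - v) ^ 2 / (2 * lam))
    (hproxρ : ∀ x v : ℝ,
      logisticRho (proxρ x) + (x - proxρ x) ^ 2 / (2 * lam)
        ≤ logisticRho v + (x - v) ^ 2 / (2 * lam)) :
    1 - lam * ∫ ω, logisticL'' (proxl (Real.sqrt κ * α * Z ω + r * σ * V ω)) /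
          (1 + lam * logisticL'' (proxl (Real.sqrt κ * α * Z ω + r * σ * V ω))) ∂ℙ
      = ∫ ω, 2 * logisticRho' (r * V' ω) /
          (1 + lam * logisticRho'' (proxρ (-(Real.sqrt κ) * α * Z' ω - r * σ * V' ω))) ∂ℙ := by
  set g : ℝ → ℝ := fun x => 1 / (1 + lam * logisticRho'' (proxρ (-x))) with hg
  have hprox (x : ℝ) : -proxl x = proxρ (-x) := by
    refine logisticRho_prox_unique hlam (x := -x) (fun v => ?_) (hproxρ (-x))
    have h := hproxl x (-v)
    simp only [logisticL, neg_neg] at h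
    simp only [logisticRho]
    convert h using 3 <;> ring
  have hden (x : ℝ) : 1 ≤ 1 + lam * logisticRho'' x :=
    le_add_of_nonneg_right (mul_nonneg hlam.le (logisticRho''_nonneg x))
  have hgmeas : Measurable g := by
    have hp := (monotone_of_prox hlam hproxρ).measurable
    exact measurable_const.div
      (((measurable_logisticRho''.comp (hp.comp measurable_neg)).const_mul lam).const_add 1)
  have hgint : Integrable (fun ω => g (Real.sqrt κ * α * Z ω + r * σ * V ω)) ℙ := by
    refine Integrable.of_bound (C := 1) (hgmeas.comp (by fun_prop)).aestronglyMeasurable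
      (Filter.Eventually.of_forall fun ω => ?_)
    have h := hden (proxρ (-(Real.sqrt κ * α * Z ω + r * σ * V ω)))
    rw [hg, Real.norm_of_nonneg (by positivity)]
    exact (div_le_one (by positivity)).2 h
  have hleft : 1 - lam * ∫ ω, logisticL'' (proxl (Real.sqrt κ * α * Z ω + r * σ * V ω)) /
          (1 + lam * logisticL'' (proxl (Real.sqrt κ * α * Z ω + r * σ * V ω))) ∂ℙ
      = ∫ ω, g (Real.sqrt κ * α * Z ω + r * σ * V ω) ∂ℙ := by
    have hpt (ω : Ω) : lam * (logisticL'' (proxl (Real.sqrt κ * α * Z ω + r * σ * V ω)) /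
          (1 + lam * logisticL'' (proxl (Real.sqrt κ * α * Z ω + r * σ * V ω))))
        = 1 - g (Real.sqrt κ * α * Z ω + r * σ * V ω) := by
      simp only [logisticL'', hprox, hg]
      have h := hden (proxρ (-(Real.sqrt κ * α * Z ω + r * σ * V ω)))
      field_simp
      ring
    rw [← integral_const_mul, integral_congr_ae (Filter.Eventually.of_forall hpt),
      integral_sub (integrable_const 1) hgint]
    simp
  have hlawZV := (indepFun_iff_map_prod_eq_prod_map_map hZ.aemeasurable hV.aemeasurable).1 hindepZV
  have hlawZV' :=
    (indepFun_iff_map_prod_eq_prod_map_map hZ'.aemeasurable hV'.aemeasurable).1 hindepZ'V'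
  have hρ'meas : Measurable fun v => 2 * logisticRho' (r * v) :=
    (measurable_logisticRho'.comp (measurable_const_mul r)).const_mul 2
  rw [hZlaw, hVlaw, gaussianReal_withDensity_logisticRho',
    prod_withDensity_right hρ'meas.ennreal_ofReal] at hlawZV
  rw [hZ'law, hV'law] at hlawZV'
  have hGmeas : Measurable fun z : ℝ × ℝ => g (Real.sqrt κ * α * z.1 + r * σ * z.2) :=
    hgmeas.comp (by fun_prop)
  have hwmeas : Measurable fun z : ℝ × ℝ => 2 * logisticRho' (r * z.2) :=
    hρ'meas.comp measurable_snd
  have hHmeas : Measurable fun z : ℝ × ℝ =>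
      (2 * logisticRho' (r * z.2)) * g (Real.sqrt κ * α * z.1 + r * σ * z.2) :=
    hwmeas.mul hGmeas
  calc
    _ = ∫ ω, g (Real.sqrt κ * α * Z ω + r * σ * V ω) ∂ℙ := hleft
    _ = ∫ z, g (Real.sqrt κ * α * z.1 + r * σ * z.2)
          ∂(Measure.map (fun ω => (Z ω, V ω)) ℙ) :=
      (integral_map (hZ.prodMk hV).aemeasurable hGmeas.aestronglyMeasurable).symm
    _ = ∫ z, (2 * logisticRho' (r * z.2)) * g (Real.sqrt κ * α * z.1 + r * σ * z.2)
          ∂((gaussianReal 0 1).prod (gaussianReal 0 1)) := by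
      rw [hlawZV, integral_withDensity_eq_integral_toReal_smul
        hwmeas.ennreal_ofReal
        (Filter.Eventually.of_forall fun _ => ENNReal.ofReal_lt_top)]
      refine integral_congr_ae (Filter.Eventually.of_forall fun z => ?_)
      simp only [smul_eq_mul]
      rw [ENNReal.toReal_ofReal (mul_nonneg zero_le_two (logisticRho'_nonneg _))]
    _ = ∫ ω, (2 * logisticRho' (r * V' ω)) * g (Real.sqrt κ * α * Z' ω + r * σ * V' ω) ∂ℙ := by
      rw [← hlawZV', integral_map (hZ'.prodMk hV').aemeasurable hHmeas.aestronglyMeasurable]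
    _ = _ := by
      refine integral_congr_ae (Filter.Eventually.of_forall fun ω => ?_)
      have harg : -(Real.sqrt κ * α * Z' ω + r * σ * V' ω)
          = -(Real.sqrt κ) * α * Z' ω - r * σ * V' ω := by ring
      simp only [hg, harg, mul_one_div]
end
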